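/- There exists a branched cover of the 2-sphere by a closed orientable surface of genus g with branch points of local orders n₁+1, ..., n_k+1 (where 1 ≤ n₁ ≤ ... ≤ n_k) if and only if there exists an integer d ≥ 1 such that Σᵢ nᵢ = 2(g + d − 1) and nᵢ ≤ d − 1 for every i. -/

import Mathlib

open Equiv

/-- `σ` cyclically permutes the elements of `s` and fixes all other elements. -/
def IsCyclicPermOn {α : Type*} [DecidableEq α] (s : Finset α) (σ : Perm α) : Prop :=
  ∃ l : List α, l.Nodup ∧ l.toFinset = s ∧ l.formPerm = σ

/-- A cycle of length `n + 1`, where cycles of length `1` are trivial. -/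
def HasCycleOrder {α : Type*} [Fintype α] [DecidableEq α] (n : ℕ) (σ : Perm α) : Prop :=
  σ.cycleType = if n = 0 then 0 else {n + 1}

/-- The list `L` of orders is realized by cycles with trivial product which generate a
transitive group of permutations of `α`. -/
def IsRealizable (α : Type*) [Fintype α] [DecidableEq α] (L : List ℕ) : Prop :=
  ∃ A : List (Perm α), List.Forall₂ HasCycleOrder L A ∧ A.prod = 1 ∧
    ∀ x y : α, ∃ σ ∈ Subgroup.closure {τ | τ ∈ A}, σ x = y

theorem List.exists_cons_isRotated_of_mem {α : Type*} {l : List α} {z : α} (hz : z ∈ l) :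
    ∃ t, l ~r z :: t := by
  obtain ⟨s, t, rfl⟩ := List.mem_iff_append.mp hz
  exact ⟨t ++ s, by simpa using List.isRotated_append (l := s) (l' := z :: t)⟩

theorem List.formPerm_append_cons {α : Type*} [DecidableEq α] (l : List α) (x : α) (m : List α) :
    (l ++ x :: m).formPerm = (l ++ [x]).formPerm * (x :: m).formPerm := by
  induction l with
  | nil => simp
  | cons a l ih =>
    cases l with
    | nil => simp [List.formPerm_cons_cons]
    | cons b l =>
      simp only [List.cons_append, List.formPerm_cons_cons] at ih ⊢
      rw [ih, mul_assoc]

theorem isCyclicPermOn_cons {α : Type*} [DecidableEq α] {s : Finset α} {σ : Perm α} {z : α}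
    (h : IsCyclicPermOn s σ) (hz : z ∈ s) :
    ∃ l : List α, (z :: l).Nodup ∧ (z :: l).toFinset = s ∧ (z :: l).formPerm = σ := by
  obtain ⟨l, hl, rfl, rfl⟩ := h
  obtain ⟨t, ht⟩ := List.exists_cons_isRotated_of_mem (List.mem_toFinset.mp hz)
  exact ⟨t, ht.nodup_iff.mp hl, (List.toFinset_eq_of_perm _ _ ht.perm).symm,
    (List.formPerm_eq_of_isRotated hl ht).symm⟩

namespace IsCyclicPermOn

variable {α : Type*} [DecidableEq α] {s t : Finset α} {σ τ : Perm α}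

theorem exists_perm (s : Finset α) : ∃ σ : Perm α, IsCyclicPermOn s σ :=
  ⟨s.toList.formPerm, s.toList, s.nodup_toList, by simp, rfl⟩

theorem inv (h : IsCyclicPermOn s σ) : IsCyclicPermOn s σ⁻¹ := by
  obtain ⟨l, hl, rfl, rfl⟩ := h
  exact ⟨l.reverse, by simpa, by simp, List.formPerm_reverse l⟩

/-- The product of two cycles which meet in exactly one point is a cycle. -/
theorem mul {z : α} (hσ : IsCyclicPermOn s σ) (hτ : IsCyclicPermOn t τ) (hst : s ∩ t = {z}) :
    IsCyclicPermOn (s ∪ t) (σ * τ) := by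
  have hz : z ∈ s ∩ t := by simp [hst]
  rw [Finset.mem_inter] at hz
  obtain ⟨l, hl, hls, rfl⟩ := isCyclicPermOn_cons hσ hz.1
  obtain ⟨m, hm, hmt, rfl⟩ := isCyclicPermOn_cons hτ hz.2
  have hmem : ∀ x, x ∈ l → x ∈ m → False := fun x hx hx' => by
    have : x ∈ s ∩ t := by simp [← hls, ← hmt, hx, hx']
    rw [hst, Finset.mem_singleton] at this
    exact (List.nodup_cons.mp hl).1 (this ▸ hx)
  have hrot : z :: l ~r l ++ [z] := List.isRotated_append (l := [z]) (l' := l)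
  refine ⟨l ++ z :: m, ?_, ?_, ?_⟩
  · rw [List.nodup_append]
    refine ⟨(List.nodup_cons.mp hl).2, hm, ?_⟩
    rintro a ha b hb rfl
    rcases List.mem_cons.mp hb with rfl | hb
    · exact (List.nodup_cons.mp hl).1 ha
    · exact hmem a ha hb
  · rw [← hls, ← hmt]
    ext x
    simp
  · rw [List.formPerm_append_cons, List.formPerm_eq_of_isRotated hl hrot]

theorem sameCycle (h : IsCyclicPermOn s σ) {x y : α} (hx : x ∈ s) (hy : y ∈ s) :
    σ.SameCycle x y := by
  obtain ⟨l, hl, rfl, rfl⟩ := h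
  exact hl.isCycleOn_formPerm.2 (by simpa using hx) (by simpa using hy)

theorem eq_one (h : IsCyclicPermOn s σ) (hs : s.card ≤ 1) : σ = 1 := by
  obtain ⟨l, hl, rfl, rfl⟩ := h
  rw [List.toFinset_card_of_nodup hl] at hs
  exact (List.formPerm_eq_one_iff l hl).mpr hs

variable [Fintype α]

theorem isCycle_and_support_eq (h : IsCyclicPermOn s σ) (hs : 2 ≤ s.card) :
    σ.IsCycle ∧ σ.support = s := by
  obtain ⟨l, hl, rfl, rfl⟩ := h
  rw [List.toFinset_card_of_nodup hl] at hs
  refine ⟨List.isCycle_formPerm hl hs, List.support_formPerm_of_nodup l hl ?_⟩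
  rintro x rfl
  simp at hs

theorem hasCycleOrder (h : IsCyclicPermOn s σ) {n : ℕ} (hs : s.card = n + 1) :
    HasCycleOrder n σ := by
  unfold HasCycleOrder
  split_ifs with hn
  · rw [h.eq_one (by omega), Perm.cycleType_one]
  · obtain ⟨hc, hsupp⟩ := h.isCycle_and_support_eq (by omega)
    rw [hc.cycleType, hsupp, hs]

end IsCyclicPermOn

theorem Equiv.Perm.IsCycle.isCyclicPermOn {α : Type*} [DecidableEq α] [Fintype α] {σ : Perm α}
    (h : σ.IsCycle) : IsCyclicPermOn σ.support σ := by
  obtain ⟨x, hx, -⟩ := id h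
  refine ⟨σ.toList x, Perm.nodup_toList σ x, ?_, ?_⟩
  · ext y
    rw [List.mem_toFinset, Perm.mem_toList_iff, Perm.mem_support, Perm.mem_support]
    exact ⟨fun hy => hy.1.apply_eq_self_iff.not.mp hy.2, fun hy => ⟨h.sameCycle hx hy, hx⟩⟩
  · rw [Perm.formPerm_toList, h.cycleOf_eq hx]

theorem IsCyclicPermOn.sq {α : Type*} [DecidableEq α] [Fintype α] {s : Finset α} {σ : Perm α}
    (h : IsCyclicPermOn s σ) (hs : Odd s.card) : IsCyclicPermOn s (σ ^ 2) := by
  rcases Nat.lt_or_ge s.card 2 with h2 | h2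
  · have := h.eq_one (by omega)
    subst this
    simpa using h
  · obtain ⟨hc, hsupp⟩ := h.isCycle_and_support_eq h2
    have hcop : Nat.Coprime 2 (orderOf σ) := by
      rwa [hc.orderOf, hsupp, Nat.coprime_two_left]
    have := (hc.pow_iff.mpr hcop).isCyclicPermOn
    rwa [Perm.support_pow_coprime hcop, hsupp] at this

/-- There are two cycles whose product is a cycle, with supports meeting in `2 * h + v + 1` points
and jointly covering `x + y + 2 * h + v + 1` points (up to the trivial cases). -/
theorem exists_cycles_mul_eq_cycle {α : Type*} [DecidableEq α] [Fintype α] (x y h v : ℕ)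
    (hcard : x + y + 2 * h + v + 1 ≤ Fintype.card α) :
    ∃ σ τ : Perm α, HasCycleOrder (x + 2 * h + v) σ ∧ HasCycleOrder (y + 2 * h + v) τ ∧
      HasCycleOrder (x + 2 * h + y) (σ * τ) ∧
      (x + y + 2 * h + v + 1 = Fintype.card α →
        ∃ z, ∀ w, σ.SameCycle z w ∨ τ.SameCycle z w) := by
  obtain ⟨Z, -, hZ⟩ := Finset.exists_subset_card_eq (s := (Finset.univ : Finset α)) (n := 1)
    (by rw [Finset.card_univ]; omega)
  obtain ⟨z, rfl⟩ := Finset.card_eq_one.mp hZ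
  have extend (S : Finset α) (n : ℕ) (hn : S.card + n ≤ Fintype.card α) :
      ∃ T : Finset α, Disjoint S T ∧ T.card = n := by
    obtain ⟨T, hT, hTn⟩ := Finset.exists_subset_card_eq (s := Sᶜ) (n := n)
      (by rw [Finset.card_compl]; omega)
    exact ⟨T, Finset.disjoint_right.mpr fun a ha => Finset.mem_compl.mp (hT ha), hTn⟩
  obtain ⟨X, hX, hXc⟩ := extend {z} x (by simp; omega)
  obtain ⟨Y, hY, hYc⟩ := extend ({z} ∪ X) y (by
    rw [Finset.card_union_of_disjoint hX, hZ]; omega)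
  obtain ⟨U, hU, hUc⟩ := extend ({z} ∪ X ∪ Y) (2 * h) (by
    rw [Finset.card_union_of_disjoint hY, Finset.card_union_of_disjoint hX, hZ]; omega)
  obtain ⟨V, hV, hVc⟩ := extend ({z} ∪ X ∪ Y ∪ U) v (by
    rw [Finset.card_union_of_disjoint hU, Finset.card_union_of_disjoint hY,
      Finset.card_union_of_disjoint hX, hZ]; omega)
  have htotal : ({z} ∪ X ∪ Y ∪ U ∪ V).card = x + y + 2 * h + v + 1 := by
    rw [Finset.card_union_of_disjoint hV, Finset.card_union_of_disjoint hU,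
      Finset.card_union_of_disjoint hY, Finset.card_union_of_disjoint hX, hZ]
    omega
  simp only [Finset.disjoint_union_left, Finset.disjoint_singleton_left] at hX hY hU hV
  obtain ⟨⟨hYz, hXY⟩, ⟨⟨hUz, hXU⟩, hYU⟩, ⟨⟨hVz, hXV⟩, hYV⟩, hUV⟩ := And.intro hY (And.intro hU hV)
  have inter {S T : Finset α} (hST : Disjoint S T) : insert z S ∩ insert z T = {z} := by
    rw [← Finset.insert_inter_distrib, Finset.disjoint_iff_inter_eq_empty.mp hST]; rfl
  have union (S T : Finset α) : insert z S ∪ insert z T = insert z (S ∪ T) :=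
    (Finset.insert_union_distrib z S T).symm
  obtain ⟨ξ, hξ⟩ := IsCyclicPermOn.exists_perm (insert z X)
  obtain ⟨η, hη⟩ := IsCyclicPermOn.exists_perm (insert z Y)
  obtain ⟨μ, hμ⟩ := IsCyclicPermOn.exists_perm (insert z U)
  obtain ⟨ν, hν⟩ := IsCyclicPermOn.exists_perm (insert z V)
  have hσ := (hξ.mul hμ (inter hXU))
  rw [union] at hσ
  replace hσ := hσ.mul hν (inter (Finset.disjoint_union_left.mpr ⟨hXV, hUV⟩))
  rw [union] at hσ
  have hτ := hν.inv.mul hμ (inter hUV.symm)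
  rw [union] at hτ
  replace hτ := hτ.mul hη (inter (Finset.disjoint_union_left.mpr ⟨hYV.symm, hYU.symm⟩))
  rw [union] at hτ
  have hμ2 := hμ.sq (by rw [Finset.card_insert_of_notMem hUz, hUc]; exact ⟨h, rfl⟩)
  have hστ := hξ.mul hμ2 (inter hXU)
  rw [union] at hστ
  replace hστ := hστ.mul hη (inter (Finset.disjoint_union_left.mpr ⟨hXY, hYU.symm⟩))
  rw [union] at hστ
  refine ⟨_, _, hσ.hasCycleOrder ?_, hτ.hasCycleOrder ?_, ?_, fun htop => ⟨z, fun w => ?_⟩⟩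
  · rw [Finset.card_insert_of_notMem (by simp [hX, hUz, hVz]),
      Finset.card_union_of_disjoint (by simp [hXV, hUV]), Finset.card_union_of_disjoint hXU]
    omega
  · rw [Finset.card_insert_of_notMem (by simp [hYz, hUz, hVz]),
      Finset.card_union_of_disjoint (by simp [hYV.symm, hYU.symm]),
      Finset.card_union_of_disjoint hUV.symm]
    omega
  · convert hστ.hasCycleOrder (n := x + 2 * h + y) ?_ using 1
    · rw [pow_two]; group
    · rw [Finset.card_insert_of_notMem (by simp [hX, hUz, hYz]),
        Finset.card_union_of_disjoint (by simp [hXY, hYU.symm]), Finset.card_union_of_disjoint hXU]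
      omega
  · have huniv := (Finset.card_eq_iff_eq_univ _).mp (htotal.trans htop)
    have hw : w ∈ {z} ∪ X ∪ Y ∪ U ∪ V := huniv ▸ Finset.mem_univ w
    by_cases hwY : w ∈ Y
    · exact Or.inr (hτ.sameCycle (by simp) (by simp [hwY]))
    · refine Or.inl (hσ.sameCycle (by simp) ?_)
      simp only [Finset.mem_union, Finset.mem_singleton, Finset.mem_insert] at hw ⊢
      tauto

theorem exists_mul_eq_of_hasCycleOrder {α : Type*} [DecidableEq α] [Fintype α] {a b c m : ℕ}
    (hm : Fintype.card α = m + 1) (hc : c = a + b ∧ c ≤ m ∨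
      a ≤ m ∧ b ≤ m ∧ c ≤ m ∧ 2 * m ≤ a + b + c ∧ Even (a + b + c))
    {γ : Perm α} (hγ : HasCycleOrder c γ) :
    ∃ σ τ : Perm α, HasCycleOrder a σ ∧ HasCycleOrder b τ ∧ σ * τ = γ := by
  obtain ⟨σ, τ, hσ, hτ, hστ⟩ : ∃ σ τ : Perm α, HasCycleOrder a σ ∧ HasCycleOrder b τ ∧
      HasCycleOrder c (σ * τ) := by
    rcases hc with ⟨rfl, hc⟩ | ⟨ha, hb, hc, h2, k, hk⟩
    · obtain ⟨σ, τ, h1, h2, h3, -⟩ := exists_cycles_mul_eq_cycle (α := α) a b 0 0 (by omega)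
      exact ⟨σ, τ, by simpa using h1, by simpa using h2, by simpa using h3⟩
    · obtain ⟨σ, τ, h1, h2, h3, -⟩ := exists_cycles_mul_eq_cycle (α := α) (m - b) (m - a)
        (k - m) (a + b + m - 2 * k) (by omega)
      refine ⟨σ, τ, ?_, ?_, ?_⟩
      · convert h1 using 1; omega
      · convert h2 using 1; omega
      · convert h3 using 1; omega
  have hconj : IsConj (σ * τ) γ := Perm.isConj_iff_cycleType_eq.mpr (hστ.trans hγ.symm)
  obtain ⟨e, he⟩ := isConj_iff.mp hconj
  refine ⟨e * σ * e⁻¹, e * τ * e⁻¹, ?_, ?_, ?_⟩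
  · exact Perm.cycleType_conj.trans hσ
  · exact Perm.cycleType_conj.trans hτ
  · rw [← he]; group

namespace IsRealizable

variable {α : Type*} [Fintype α] [DecidableEq α]

theorem of_zero_cons {L : List ℕ} (h : IsRealizable α (0 :: L)) : IsRealizable α L := by
  obtain ⟨A, hA, hprod, htrans⟩ := h
  obtain ⟨σ, A, hσ, hA', rfl⟩ := List.forall₂_cons_left_iff.mp hA
  have : σ = 1 := by simpa [HasCycleOrder] using hσ
  subst this
  refine ⟨A, hA', by simpa using hprod, fun x y => ?_⟩
  obtain ⟨σ, hσ, hxy⟩ := htrans x y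
  refine ⟨σ, ?_, hxy⟩
  refine (Subgroup.closure_le _).mpr ?_ hσ
  intro τ hτ
  rcases List.mem_cons.mp hτ with rfl | hτ
  · exact one_mem _
  · exact Subgroup.subset_closure hτ

theorem split {L₁ L₂ : List ℕ} {a b c m : ℕ}
    (hm : Fintype.card α = m + 1) (hc : c = a + b ∧ c ≤ m ∨
      a ≤ m ∧ b ≤ m ∧ c ≤ m ∧ 2 * m ≤ a + b + c ∧ Even (a + b + c))
    (h : IsRealizable α (L₁ ++ c :: L₂)) : IsRealizable α (L₁ ++ a :: b :: L₂) := by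
  obtain ⟨A, hA, hprod, htrans⟩ := h
  have h₁ := (List.forall₂_take_append A L₁ (c :: L₂) hA.flip).flip
  have h₂ := (List.forall₂_drop_append A L₁ (c :: L₂) hA.flip).flip
  obtain ⟨γ, A₂, hγ, hA₂, hdrop⟩ := List.forall₂_cons_left_iff.mp h₂
  have hAeq := List.take_append_drop L₁.length A
  generalize List.take L₁.length A = A₁ at h₁ hAeq
  rw [hdrop] at hAeq
  subst hAeq
  obtain ⟨σ, τ, hσ, hτ, rfl⟩ := exists_mul_eq_of_hasCycleOrder hm hc hγ
  refine ⟨A₁ ++ σ :: τ :: A₂, List.rel_append h₁ (.cons hσ (.cons hτ hA₂)),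
    by simpa [mul_assoc] using hprod, fun x y => ?_⟩
  obtain ⟨ρ, hρ, hxy⟩ := htrans x y
  refine ⟨ρ, (Subgroup.closure_le _).mpr ?_ hρ, hxy⟩
  intro κ hκ
  have hmem : κ ∈ A₁ ∨ κ = σ * τ ∨ κ ∈ A₂ := by simpa using hκ
  rcases hmem with hκ | rfl | hκ
  · exact Subgroup.subset_closure (by simp [hκ])
  · exact mul_mem (Subgroup.subset_closure (by simp)) (Subgroup.subset_closure (by simp))
  · exact Subgroup.subset_closure (by simp [hκ])

theorem of_three {a b c m : ℕ} (hm : Fintype.card α = m + 1) (ha : a ≤ m) (hb : b ≤ m)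
    (hc : c ≤ m) (h2 : 2 * m ≤ a + b + c) (heven : Even (a + b + c)) :
    IsRealizable α [a, b, c] := by
  obtain ⟨k, hk⟩ := heven
  obtain ⟨σ, τ, hσ, hτ, hστ, htrans⟩ := exists_cycles_mul_eq_cycle (α := α) (m - b) (m - a)
    (k - m) (a + b + m - 2 * k) (by omega)
  obtain ⟨z, hz⟩ := htrans (by omega)
  refine ⟨[σ, τ, (σ * τ)⁻¹], .cons ?_ (.cons ?_ (.cons ?_ .nil)), by simp, ?_⟩
  · convert hσ using 1; omega
  · convert hτ using 1; omega
  · refine (Perm.cycleType_inv _).trans ?_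
    convert hστ using 1
    unfold HasCycleOrder
    rw [show m - b + 2 * (k - m) + (m - a) = c by omega]
  · have key (w : α) : ∃ ρ ∈ Subgroup.closure {κ | κ ∈ [σ, τ, (σ * τ)⁻¹]}, ρ z = w := by
      rcases hz w with ⟨i, hi⟩ | ⟨i, hi⟩
      · exact ⟨σ ^ i, zpow_mem (Subgroup.subset_closure (by simp)) i, hi⟩
      · exact ⟨τ ^ i, zpow_mem (Subgroup.subset_closure (by simp)) i, hi⟩
    intro x y
    obtain ⟨ρ, hρ, rfl⟩ := key x
    obtain ⟨κ, hκ, rfl⟩ := key y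
    exact ⟨κ * ρ⁻¹, mul_mem hκ (inv_mem hρ), by simp⟩

theorem of_length_add_three {m : ℕ} (hm : Fintype.card α = m + 1) (r : ℕ) :
    ∀ L : List ℕ, L.length = r + 3 → (∀ a ∈ L, a ≤ m) → 2 * m ≤ L.sum → Even L.sum →
      IsRealizable α L := by
  induction r with
  | zero =>
    intro L hL hle h2 heven
    obtain ⟨a, b, c, rfl⟩ := List.length_eq_three.mp hL
    simp only [List.mem_cons, List.not_mem_nil, or_false, forall_eq_or_imp, forall_eq] at hle
    simp only [List.sum_cons, List.sum_nil, add_zero, ← add_assoc] at h2 heven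
    exact of_three hm hle.1 hle.2.1 hle.2.2 h2 heven
  | succ r ih =>
    intro L hL hle h2 heven
    obtain _ | ⟨a, _ | ⟨b, _ | ⟨a', _ | ⟨b', L⟩⟩⟩⟩ := L <;>
      simp only [List.length_cons, List.length_nil] at hL <;> try omega
    simp only [List.mem_cons, forall_eq_or_imp] at hle
    obtain ⟨ha, hb, ha', hb', hle⟩ := hle
    simp only [List.sum_cons, Nat.even_iff] at h2 heven
    by_cases hab : a + b ≤ m
    · refine split (L₁ := []) hm (Or.inl ⟨rfl, hab⟩) (ih _ ?_ ?_ ?_ ?_)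
      · simp; omega
      · simpa using ⟨hab, ha', hb', hle⟩
      · simp; omega
      · simp [Nat.even_iff]; omega
    by_cases hab' : a' + b' ≤ m
    · refine split (L₁ := [a, b]) hm (Or.inl ⟨rfl, hab'⟩) (ih _ ?_ ?_ ?_ ?_)
      · simp; omega
      · simpa using ⟨ha, hb, hab', hle⟩
      · simp; omega
      · simp [Nat.even_iff]; omega
    obtain ⟨c, hc, hcm, hpar⟩ : ∃ c ≤ m, m ≤ c + 1 ∧ (a + b + c) % 2 = 0 := by
      by_cases hpar : (a + b + m) % 2 = 0
      · exact ⟨m, le_rfl, by omega, hpar⟩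
      · exact ⟨m - 1, by omega, by omega, by omega⟩
    refine split (L₁ := []) hm (Or.inr ⟨ha, hb, hc, by omega, Nat.even_iff.mpr hpar⟩)
      (ih _ ?_ ?_ ?_ ?_)
    · simp; omega
    · simpa using ⟨hc, ha', hb', hle⟩
    · simp; omega
    · simp [Nat.even_iff]; omega

theorem of_le_sum {m : ℕ} (hm : Fintype.card α = m + 1) {L : List ℕ} (hle : ∀ a ∈ L, a ≤ m)
    (h2 : 2 * m ≤ L.sum) (heven : Even L.sum) : IsRealizable α L :=
  (of_length_add_three hm L.length (0 :: 0 :: 0 :: L) (by simp) (by simpa using hle)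
    (by simpa using h2) (by simpa using heven)).of_zero_cons.of_zero_cons.of_zero_cons

end IsRealizable

/-- By Hurwitz's theorem, a branched cover of the sphere by a connected closed orientable
surface of genus `g`, of degree `d`, with branch points of local orders `n i + 1`, exists
if and only if there are `(n i + 1)`-cycles in `S_d` with product the identity generating a
transitive subgroup, the genus being determined by the Riemann–Hurwitz formula
`∑ i, n i = 2 * (g + d - 1)`. -/
theorem branched_cover_of_sphere_exists_iff
    (g k : ℕ) (n : Fin k → ℕ) (hmono : Monotone n) (h1 : ∀ i, 1 ≤ n i) :
    (∃ d : ℕ, 1 ≤ d ∧ (∑ i, n i) = 2 * (g + d - 1) ∧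
      ∃ α : Fin k → Perm (Fin d),
        (∀ i, (α i).cycleType = {n i + 1}) ∧
        (List.ofFn α).prod = 1 ∧
        (∀ x y : Fin d, ∃ σ ∈ Subgroup.closure (Set.range α), σ x = y))
    ↔ (∃ d : ℕ, 1 ≤ d ∧ (∑ i, n i) = 2 * (g + d - 1) ∧ ∀ i, n i ≤ d - 1) := by
  constructor
  · rintro ⟨d, hd, hsum, α, hα, -, -⟩
    refine ⟨d, hd, hsum, fun i => ?_⟩
    have h := Perm.sum_cycleType (α i)
    rw [hα i, Multiset.sum_singleton] at h
    have hle := Finset.card_le_univ (α i).support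
    rw [Fintype.card_fin] at hle
    omega
  · rintro ⟨d, hd, hsum, hle⟩
    obtain ⟨A, hA, hprod, htrans⟩ := IsRealizable.of_le_sum (α := Fin d) (m := d - 1)
      (L := List.ofFn n) (by rw [Fintype.card_fin]; omega)
      (by simpa [List.mem_ofFn] using hle) (by rw [List.sum_ofFn]; omega)
      (by rw [List.sum_ofFn, hsum]; exact even_two_mul _)
    obtain ⟨hlen, hget⟩ := List.forall₂_iff_get.mp hA
    rw [List.length_ofFn] at hlen
    subst hlen
    refine ⟨d, hd, hsum, A.get, fun i => ?_, by rwa [List.ofFn_get], ?_⟩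
    · have h := hget i (by simp) i.2
      have hi := h1 i
      simpa [HasCycleOrder, show n i ≠ 0 by omega] using h
    · have hset : Set.range A.get = {τ | τ ∈ A} := by
        ext τ
        simp [List.mem_iff_get]
      rwa [hset]
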